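/- arXiv:2305.14921 — 4 statements merged into one kernel-verified Lean document; each statement's English description precedes it below -/
import Mathlib

section
/- Optimality of the LQ state-feedback law: suppose P is positive semidefinite and satisfies the algebraic Riccati equation P = A'PA + Q − A'PB(R + B'PB)⁻¹B'PA, K = −(R + B'PB)⁻¹B'PA, and the matrix A + BK is stable. Then (i) for every control sequence u(·) whose state trajectory x(k+1) = A x(k) + B u(k), x(0) = x₀ satisfies x(k) → 0 as k → ∞, the infinite-horizon cost J = Σ_{k=0}^{∞} (x(k)'Q x(k) + u(k)'R u(k)) satisfies J ≥ x₀'P x₀; and (ii) the control u*(k) = K x(k) achieves J = x₀'P x₀. -/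
open Matrix Filter Topology

/-- A square real matrix is (Schur) stable if every complex eigenvalue has modulus `< 1`. -/
def IsStable {ι : Type*} [Fintype ι] [DecidableEq ι] (M : Matrix ι ι ℝ) : Prop :=
  ∀ μ ∈ spectrum ℂ (M.map (algebraMap ℝ ℂ)), ‖μ‖ < 1

attribute [local instance] Matrix.linftyOpNormedRing Matrix.linftyOpNormedAlgebra in
theorem stable_pow_tendsto_complex {n : ℕ} (M : Matrix (Fin n) (Fin n) ℂ)
    (h : ∀ μ ∈ spectrum ℂ M, ‖μ‖ < 1) : Tendsto (fun k => M ^ k) atTop (𝓝 0) := by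
  rcases isEmpty_or_nonempty (Fin n) with he | hne
  · have : Subsingleton (Matrix (Fin n) (Fin n) ℂ) := inferInstance
    have e : (fun k => M ^ k) = fun _ => (0 : Matrix (Fin n) (Fin n) ℂ) := by
      funext k; exact Subsingleton.elim _ _
    rw [e]; exact tendsto_const_nhds
  have : CompleteSpace (Matrix (Fin n) (Fin n) ℂ) := FiniteDimensional.complete ℂ _
  have hr : spectralRadius ℂ M < (1 : NNReal) :=
    spectrum.spectralRadius_lt_of_forall_lt M (fun z hz => by
      have := h z hz
      exact_mod_cast this)
  have hg := spectrum.pow_nnnorm_pow_one_div_tendsto_nhds_spectralRadius M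
  obtain ⟨r, hr1, hr2⟩ := ENNReal.lt_iff_exists_nnreal_btwn.1 hr
  have hr2' : r < 1 := by exact_mod_cast hr2
  have hev : ∀ᶠ k : ℕ in atTop, ‖M ^ k‖₊ ≤ r ^ k := by
    filter_upwards [hg.eventually (gt_mem_nhds hr1), eventually_gt_atTop 0] with k hk hk0
    have h2 : ((‖M ^ k‖₊ : ENNReal) ^ (1 / k : ℝ)) ^ (k : ℝ) ≤ (r : ENNReal) ^ (k : ℝ) :=
      ENNReal.rpow_le_rpow hk.le (by positivity)
    rw [← ENNReal.rpow_mul, one_div, inv_mul_cancel₀ (by positivity), ENNReal.rpow_one,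
      ENNReal.rpow_natCast] at h2
    exact_mod_cast h2
  apply squeeze_zero_norm' (a := fun k => (r : ℝ) ^ k)
  · filter_upwards [hev] with k hk
    exact_mod_cast hk
  · exact tendsto_pow_atTop_nhds_zero_of_lt_one r.2 (by exact_mod_cast hr2')

theorem stable_traj {n : ℕ} (M : Matrix (Fin n) (Fin n) ℝ) (h : IsStable M)
    (x : ℕ → Fin n → ℝ) (hx : ∀ k, x (k + 1) = M.mulVec (x k)) :
    Tendsto x atTop (𝓝 0) := by
  have h1 := stable_pow_tendsto_complex _ h
  have h2 : Tendsto (fun k => M ^ k) atTop (𝓝 0) := by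
    refine tendsto_pi_nhds.2 fun i => tendsto_pi_nhds.2 fun j => ?_
    have h3 := (tendsto_pi_nhds.1 ((tendsto_pi_nhds.1 h1) i)) j
    have h4 := (Complex.continuous_re.tendsto _).comp h3
    refine (h4.congr ?_).trans ?_
    · intro k
      have : (M.map (algebraMap ℝ ℂ)) ^ k = (M ^ k).map (algebraMap ℝ ℂ) :=
        (map_pow (algebraMap ℝ ℂ).mapMatrix M k).symm
      rw [Function.comp_apply, this]; simp
    · simp
  have h5 : ∀ k, x k = (M ^ k).mulVec (x 0) := by
    intro k
    induction k with
    | zero => simp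
    | succ k ih => rw [hx, ih, Matrix.mulVec_mulVec, pow_succ']
  have h6 : Continuous fun N : Matrix (Fin n) (Fin n) ℝ => N.mulVec (x 0) := by fun_prop
  have h7 := (h6.tendsto 0).comp h2
  rw [Matrix.zero_mulVec] at h7
  exact h7.congr fun k => (h5 k).symm

theorem quad_symm {n : ℕ} {P : Matrix (Fin n) (Fin n) ℝ} (hP : P.IsHermitian)
    (a b : Fin n → ℝ) : a ⬝ᵥ P.mulVec b = b ⬝ᵥ P.mulVec a := by
  have h : Pᵀ = P := by
    rw [← Matrix.conjTranspose_eq_transpose_of_trivial]; exact hP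
  rw [Matrix.dotProduct_mulVec, ← Matrix.mulVec_transpose, h, dotProduct_comm]

theorem stage_identity {n m : ℕ}
    (A : Matrix (Fin n) (Fin n) ℝ) (B : Matrix (Fin n) (Fin m) ℝ)
    (Q : Matrix (Fin n) (Fin n) ℝ) (R : Matrix (Fin m) (Fin m) ℝ)
    (P : Matrix (Fin n) (Fin n) ℝ) (K : Matrix (Fin m) (Fin n) ℝ)
    (hR : R.PosDef) (hP : P.PosSemidef)
    (hARE : P = Aᵀ * P * A + Q - Aᵀ * P * B * (R + Bᵀ * P * B)⁻¹ * (Bᵀ * P * A))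
    (hK : K = -((R + Bᵀ * P * B)⁻¹ * (Bᵀ * P * A)))
    (x : Fin n → ℝ) (u : Fin m → ℝ) :
    x ⬝ᵥ Q.mulVec x + u ⬝ᵥ R.mulVec u =
      x ⬝ᵥ P.mulVec x - (A.mulVec x + B.mulVec u) ⬝ᵥ P.mulVec (A.mulVec x + B.mulVec u)
      + ((u - K.mulVec x) ⬝ᵥ R.mulVec (u - K.mulVec x)
        + (B.mulVec (u - K.mulVec x)) ⬝ᵥ P.mulVec (B.mulVec (u - K.mulVec x))) := by
  have hS : (R + Bᵀ * P * B).PosDef := by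
    have := hP.conjTranspose_mul_mul_same B
    rw [Matrix.conjTranspose_eq_transpose_of_trivial] at this
    exact hR.add_posSemidef this
  have hSK : (R + Bᵀ * P * B) * K = -(Bᵀ * P * A) := by
    rw [hK, Matrix.mul_neg, Matrix.mul_nonsing_inv_cancel_left]
    exact (Matrix.isUnit_iff_isUnit_det _).1 hS.isUnit
  have hP2 : P = Aᵀ * P * A + Q + Aᵀ * P * B * K := by
    rw [hK, Matrix.mul_neg, ← sub_eq_add_neg, ← Matrix.mul_assoc]
    exact hARE
  have tr : ∀ {p q : ℕ} (C : Matrix (Fin p) (Fin q) ℝ) (v : Fin q → ℝ) (z : Fin p → ℝ),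
      v ⬝ᵥ Cᵀ.mulVec z = C.mulVec v ⬝ᵥ z := by
    intro p q C v z
    rw [Matrix.mulVec_transpose, dotProduct_comm, ← Matrix.dotProduct_mulVec, dotProduct_comm]
  have F1 : x ⬝ᵥ P.mulVec x = A.mulVec x ⬝ᵥ P.mulVec (A.mulVec x) + x ⬝ᵥ Q.mulVec x
      + A.mulVec x ⬝ᵥ P.mulVec (B.mulVec (K.mulVec x)) := by
    conv_lhs => rw [hP2]
    simp only [Matrix.add_mulVec, dotProduct_add, ← Matrix.mulVec_mulVec, tr]
  have F2 : ∀ v : Fin m → ℝ, v ⬝ᵥ R.mulVec (K.mulVec x)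
      + B.mulVec v ⬝ᵥ P.mulVec (B.mulVec (K.mulVec x)) = - (B.mulVec v ⬝ᵥ P.mulVec (A.mulVec x)) := by
    intro v
    have := congrArg (fun N => v ⬝ᵥ N.mulVec x) hSK
    simpa only [Matrix.add_mulVec, Matrix.neg_mulVec, dotProduct_neg, dotProduct_add,
      ← Matrix.mulVec_mulVec, tr] using this
  have e1 := F2 u
  have e2 := F2 (K.mulVec x)
  have s1 := quad_symm hR.1 u (K.mulVec x)
  have s2 := quad_symm hP.1 (B.mulVec u) (B.mulVec (K.mulVec x))
  have s3 := quad_symm hP.1 (A.mulVec x) (B.mulVec (K.mulVec x))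
  have s4 := quad_symm hP.1 (A.mulVec x) (B.mulVec u)
  simp only [Matrix.mulVec_add, Matrix.mulVec_sub, dotProduct_add, dotProduct_sub,
    add_dotProduct, sub_dotProduct]
  linarith

theorem quad_nonneg {n : ℕ} {P : Matrix (Fin n) (Fin n) ℝ} (hP : P.PosSemidef)
    (a : Fin n → ℝ) : 0 ≤ a ⬝ᵥ P.mulVec a := by
  simpa using hP.dotProduct_mulVec_nonneg a

/-- Optimality of the LQ state-feedback law `u*(k) = K x(k)`:
(i) every control whose trajectory converges to `0` has infinite-horizon cost at least
`x₀'P x₀`; (ii) the feedback `u* = Kx` achieves cost exactly `x₀'P x₀`.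
The (possibly infinite) cost is expressed as a `tsum` in `ℝ≥0∞` of the nonnegative
stage costs. -/
theorem lq_state_feedback_optimal {n m : ℕ}
    (A : Matrix (Fin n) (Fin n) ℝ) (B : Matrix (Fin n) (Fin m) ℝ)
    (Q : Matrix (Fin n) (Fin n) ℝ) (R : Matrix (Fin m) (Fin m) ℝ)
    (P : Matrix (Fin n) (Fin n) ℝ) (K : Matrix (Fin m) (Fin n) ℝ)
    (hQ : Q.PosSemidef) (hR : R.PosDef) (hP : P.PosSemidef)
    (hARE : P = Aᵀ * P * A + Q - Aᵀ * P * B * (R + Bᵀ * P * B)⁻¹ * (Bᵀ * P * A))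
    (hK : K = -((R + Bᵀ * P * B)⁻¹ * (Bᵀ * P * A)))
    (hstab : IsStable (A + B * K))
    (x₀ : Fin n → ℝ) :
    (∀ (x : ℕ → Fin n → ℝ) (u : ℕ → Fin m → ℝ),
        x 0 = x₀ →
        (∀ k, x (k + 1) = A.mulVec (x k) + B.mulVec (u k)) →
        Tendsto x atTop (𝓝 0) →
        ENNReal.ofReal (x₀ ⬝ᵥ P.mulVec x₀) ≤
          ∑' k : ℕ, ENNReal.ofReal (x k ⬝ᵥ Q.mulVec (x k) + u k ⬝ᵥ R.mulVec (u k))) ∧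
    (∀ (x : ℕ → Fin n → ℝ) (u : ℕ → Fin m → ℝ),
        x 0 = x₀ →
        (∀ k, u k = K.mulVec (x k)) →
        (∀ k, x (k + 1) = A.mulVec (x k) + B.mulVec (u k)) →
        ∑' k : ℕ, ENNReal.ofReal (x k ⬝ᵥ Q.mulVec (x k) + u k ⬝ᵥ R.mulVec (u k)) =
          ENNReal.ofReal (x₀ ⬝ᵥ P.mulVec x₀)) := by
  have key := stage_identity A B Q R P K hR hP hARE hK
  have hc : ∀ (x : Fin n → ℝ) (u : Fin m → ℝ), 0 ≤ x ⬝ᵥ Q.mulVec x + u ⬝ᵥ R.mulVec u :=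
    fun x u => add_nonneg (quad_nonneg hQ x) (quad_nonneg hR.posSemidef u)
  have lim : ∀ x : ℕ → Fin n → ℝ, x 0 = x₀ → Tendsto x atTop (𝓝 0) →
      Tendsto (fun N => ENNReal.ofReal (x 0 ⬝ᵥ P.mulVec (x 0) - x N ⬝ᵥ P.mulVec (x N))) atTop
        (𝓝 (ENNReal.ofReal (x₀ ⬝ᵥ P.mulVec x₀))) := by
    intro x h0 hx
    have hcont : Continuous fun z : Fin n → ℝ =>
        ENNReal.ofReal (x 0 ⬝ᵥ P.mulVec (x 0) - z ⬝ᵥ P.mulVec z) :=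
      ENNReal.continuous_ofReal.comp (by fun_prop)
    have := (hcont.tendsto 0).comp hx
    simpa [h0, Function.comp_def] using this
  constructor
  · intro x u h0 hx ht
    refine le_of_tendsto (lim x h0 ht) (Eventually.of_forall fun N => ?_)
    refine le_trans ?_ (ENNReal.sum_le_tsum (Finset.range N))
    rw [← ENNReal.ofReal_sum_of_nonneg (fun k _ => hc _ _),
      ← Finset.sum_range_sub' (fun k => x k ⬝ᵥ P.mulVec (x k))]
    refine ENNReal.ofReal_le_ofReal (Finset.sum_le_sum fun k _ => ?_)
    rw [key (x k) (u k), ← hx k]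
    have h1 := quad_nonneg hR.posSemidef (u k - K.mulVec (x k))
    have h2 := quad_nonneg hP (B.mulVec (u k - K.mulVec (x k)))
    linarith
  · intro x u h0 hu hx
    have ht : Tendsto x atTop (𝓝 0) := by
      refine stable_traj _ hstab x fun k => ?_
      rw [hx, hu, Matrix.add_mulVec, Matrix.mulVec_mulVec]
    refine tendsto_nhds_unique ENNReal.summable.hasSum.tendsto_sum_nat
      ((lim x h0 ht).congr fun N => ?_)
    rw [← ENNReal.ofReal_sum_of_nonneg (fun k _ => hc _ _),
      ← Finset.sum_range_sub' (fun k => x k ⬝ᵥ P.mulVec (x k))]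
    congr 1
    refine Finset.sum_congr rfl fun k _ => ?_
    rw [key (x k) (u k), ← hx k, hu k]
    simp
end

section
/- (Theorem 3) Stability under decentralized control with private input information: consider the closed loop x(k+1) = A x(k) + B₁K₁ x̂₁(k) + B₂K₂ x̂₂(k) with observers x̂₁(k+1) = A x̂₁(k) + B₁K₁x̂₁(k) + B₂K₂ x̂₁(k) + L₁(H₁x(k) − H₁ x̂₁(k)) and x̂₂(k+1) = A x̂₂(k) + B₁K₁ x̂₂(k) + B₂K₂x̂₂(k) + L₂(H₂x(k) − H₂ x̂₂(k)). If the observer gains L₁, L₂ are chosen so that the matrix 𝒜 = [[A + B₂K₂ − L₁H₁, −B₂K₂], [−B₁K₁, A + B₁K₁ − L₂H₂]] is stable, then ‖x̂_i(k) − x(k)‖ → 0 as k → ∞ for i = 1,2, for all initial conditions. If in addition A + B₁K₁ + B₂K₂ is stable, then x(k) → 0 as k → ∞ for all initial conditions. -/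
open Matrix Filter Topology

section helpers
attribute [local instance] Matrix.linftyOpNormedRing Matrix.linftyOpNormedAlgebra

theorem pow_tendsto_aux {ι : Type*} [Fintype ι] [DecidableEq ι] [Nonempty ι] (N : Matrix ι ι ℂ)
    (h : ∀ μ ∈ spectrum ℂ N, ‖μ‖ < 1) (i j : ι) :
    Tendsto (fun k : ℕ => (N ^ k) i j) atTop (𝓝 0) := by
  have h1 : spectralRadius ℂ N < ((1 : NNReal) : ENNReal) :=
    spectrum.spectralRadius_lt_of_forall_lt N (fun μ hμ => by
      have := h μ hμ
      exact_mod_cast this)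
  obtain ⟨c, hc1, hc2⟩ := ENNReal.lt_iff_exists_nnreal_btwn.1 h1
  have hc2' : c < 1 := by exact_mod_cast hc2
  have h2 := spectrum.pow_nnnorm_pow_one_div_tendsto_nhds_spectralRadius N
  have h3 := h2.eventually_lt_const hc1
  have h4 : Tendsto (fun k : ℕ => (c : ℝ) ^ k) atTop (𝓝 0) :=
    tendsto_pow_atTop_nhds_zero_of_lt_one c.2 (by exact_mod_cast hc2')
  refine squeeze_zero_norm' ?_ h4
  filter_upwards [h3, eventually_gt_atTop 0] with k hk hk0
  have h5 : (‖N ^ k‖₊ : ENNReal) ≤ (c : ENNReal) ^ k := by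
    have hk' : (0:ℝ) < 1 / (k:ℝ) := by positivity
    have h6 : (‖N ^ k‖₊ : ENNReal) ^ (1 / (k:ℝ)) ≤ ((c : ENNReal) ^ k) ^ (1 / (k:ℝ)) := by
      refine hk.le.trans (le_of_eq ?_)
      rw [← ENNReal.rpow_natCast, ← ENNReal.rpow_mul]
      have : (k:ℝ) * (1 / (k:ℝ)) = 1 := by field_simp
      rw [this, ENNReal.rpow_one]
    exact (ENNReal.rpow_le_rpow_iff hk').1 h6
  have h7 : ‖N ^ k‖₊ ≤ c ^ k := by exact_mod_cast h5
  have h8 : ‖(N ^ k) i j‖₊ ≤ ‖N ^ k‖₊ := by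
    rw [Matrix.linfty_opNNNorm_def]
    refine le_trans ?_ (Finset.le_sup (Finset.mem_univ i))
    exact Finset.single_le_sum (f := fun j => ‖(N ^ k) i j‖₊) (fun _ _ => zero_le) (Finset.mem_univ j)
  exact_mod_cast h8.trans h7
end helpers

theorem stable_tendsto_aux {ι : Type*} [Fintype ι] [DecidableEq ι] (M : Matrix ι ι ℝ)
    (h : IsStable M) (v : ℕ → ι → ℝ) (hv : ∀ k, v (k + 1) = M *ᵥ v k) :
    Tendsto v atTop (𝓝 0) := by
  have hk : ∀ k, v k = (M ^ k) *ᵥ v 0 := by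
    intro k
    induction k with
    | zero => simp
    | succ k ih => rw [hv, ih, pow_succ', Matrix.mulVec_mulVec]
  have hM : ∀ i j, Tendsto (fun k : ℕ => (M ^ k) i j) atTop (𝓝 0) := by
    intro i j
    haveI : Nonempty ι := ⟨i⟩
    have h1 := pow_tendsto_aux _ h i j
    have h2 : ∀ k : ℕ, (M.map (algebraMap ℝ ℂ) ^ k) i j = (((M ^ k) i j : ℝ) : ℂ) := by
      intro k
      have := (map_pow (algebraMap ℝ ℂ).mapMatrix M k)
      rw [RingHom.mapMatrix_apply, RingHom.mapMatrix_apply] at this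
      rw [← this]; rfl
    simp only [h2] at h1
    have := (Complex.continuous_re.tendsto 0).comp h1
    simpa [Function.comp_def] using this
  rw [tendsto_pi_nhds]
  intro i
  have : (fun k => v k i) = fun k => ∑ j, (M ^ k) i j * v 0 j := by
    funext k; rw [hk]; rfl
  rw [this]
  have := tendsto_finsetSum (Finset.univ) (fun j _ => (hM i j).mul_const (v 0 j))
  simpa using this

theorem stable_blocks_aux {ι κ : Type*} [Fintype ι] [DecidableEq ι] [Fintype κ] [DecidableEq κ]
    (P : Matrix ι ι ℝ) (Q : Matrix ι κ ℝ) (R : Matrix κ κ ℝ) (hP : IsStable P) (hR : IsStable R) :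
    IsStable (fromBlocks P Q 0 R) := by
  intro μ hμ
  rw [Matrix.mem_spectrum_iff_isRoot_charpoly, Matrix.fromBlocks_map,
    Matrix.map_zero _ (map_zero _), Matrix.charpoly_fromBlocks_zero₂₁, Polynomial.root_mul] at hμ
  rcases hμ with hμ | hμ
  · exact hP μ (Matrix.mem_spectrum_iff_isRoot_charpoly.2 hμ)
  · exact hR μ (Matrix.mem_spectrum_iff_isRoot_charpoly.2 hμ)

/-- Theorem 3: stability under decentralized control with private input information.
If `𝒜 = [[A + B₂K₂ − L₁H₁, −B₂K₂], [−B₁K₁, A + B₁K₁ − L₂H₂]]` is stable then the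
observer errors converge to zero; if moreover `A + B₁K₁ + B₂K₂` is stable then the
state converges to zero. -/
theorem stability_private_input {n m₁ m₂ s₁ s₂ : ℕ}
    (A : Matrix (Fin n) (Fin n) ℝ)
    (B₁ : Matrix (Fin n) (Fin m₁) ℝ) (B₂ : Matrix (Fin n) (Fin m₂) ℝ)
    (H₁ : Matrix (Fin s₁) (Fin n) ℝ) (H₂ : Matrix (Fin s₂) (Fin n) ℝ)
    (K₁ : Matrix (Fin m₁) (Fin n) ℝ) (K₂ : Matrix (Fin m₂) (Fin n) ℝ)
    (L₁ : Matrix (Fin n) (Fin s₁) ℝ) (L₂ : Matrix (Fin n) (Fin s₂) ℝ)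
    (hA : IsStable (fromBlocks (A + B₂ * K₂ - L₁ * H₁) (-(B₂ * K₂))
      (-(B₁ * K₁)) (A + B₁ * K₁ - L₂ * H₂)))
    (x xh₁ xh₂ : ℕ → Fin n → ℝ)
    (hx : ∀ k, x (k + 1) =
      A.mulVec (x k) + (B₁ * K₁).mulVec (xh₁ k) + (B₂ * K₂).mulVec (xh₂ k))
    (hxh₁ : ∀ k, xh₁ (k + 1) =
      A.mulVec (xh₁ k) + (B₁ * K₁).mulVec (xh₁ k) + (B₂ * K₂).mulVec (xh₁ k) +
        L₁.mulVec (H₁.mulVec (x k) - H₁.mulVec (xh₁ k)))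
    (hxh₂ : ∀ k, xh₂ (k + 1) =
      A.mulVec (xh₂ k) + (B₁ * K₁).mulVec (xh₂ k) + (B₂ * K₂).mulVec (xh₂ k) +
        L₂.mulVec (H₂.mulVec (x k) - H₂.mulVec (xh₂ k))) :
    Tendsto (fun k => xh₁ k - x k) atTop (𝓝 0) ∧
    Tendsto (fun k => xh₂ k - x k) atTop (𝓝 0) ∧
    (IsStable (A + B₁ * K₁ + B₂ * K₂) → Tendsto x atTop (𝓝 0)) := by
  have he : ∀ k, Sum.elim (xh₁ (k+1) - x (k+1)) (xh₂ (k+1) - x (k+1)) =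
      (fromBlocks (A + B₂ * K₂ - L₁ * H₁) (-(B₂ * K₂))
      (-(B₁ * K₁)) (A + B₁ * K₁ - L₂ * H₂)) *ᵥ Sum.elim (xh₁ k - x k) (xh₂ k - x k) := by
    intro k
    rw [Matrix.fromBlocks_mulVec, hx, hxh₁, hxh₂]
    simp only [Sum.elim_comp_inl, Sum.elim_comp_inr]
    congr 1 <;>
    · simp only [Matrix.mulVec_sub, Matrix.add_mulVec, Matrix.sub_mulVec, Matrix.neg_mulVec,
        Matrix.mulVec_mulVec]
      abel
  have ht := stable_tendsto_aux _ hA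
    (fun k => Sum.elim (xh₁ k - x k) (xh₂ k - x k)) he
  rw [tendsto_pi_nhds] at ht
  refine ⟨tendsto_pi_nhds.2 fun i => ht (Sum.inl i), tendsto_pi_nhds.2 fun i => ht (Sum.inr i), ?_⟩
  intro hS
  have hB := stable_blocks_aux _ (Matrix.fromCols (B₁ * K₁) (B₂ * K₂)) _ hS hA
  have ht2 := stable_tendsto_aux _ hB
    (fun k => Sum.elim (x k) (Sum.elim (xh₁ k - x k) (xh₂ k - x k))) (by
      intro k
      rw [Matrix.fromBlocks_mulVec, he k]
      simp only [Sum.elim_comp_inl, Sum.elim_comp_inr, Matrix.zero_mulVec, zero_add]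
      congr 1
      rw [Matrix.fromCols_mulVec, hx]
      simp only [Sum.elim_comp_inl, Sum.elim_comp_inr, Matrix.mulVec_sub, Matrix.add_mulVec]
      abel)
  rw [tendsto_pi_nhds] at ht2
  exact tendsto_pi_nhds.2 fun i => ht2 (Sum.inl i)
end

section
/- (Theorem 5) Closed-loop stability with r inputs under input sharing: suppose 𝒫 is positive semidefinite and satisfies 𝒫 = A'𝒫A + Q − A'𝒫𝔹(ℛ + 𝔹'𝒫𝔹)⁻¹𝔹'𝒫A with 𝒦 = −(ℛ + 𝔹'𝒫𝔹)⁻¹𝔹'𝒫A, the matrix A + 𝔹𝒦 is stable, and the observer gains L_i are such that A − L_iH_i is stable for every i = 1,…,r. Then the closed-loop system x(k+1) = A x(k) + Σ_{i=1}^{r} B_i 𝒦_i x̂_i^⋄(k), where x̂_i^⋄(k+1) = A x̂_i^⋄(k) + Σ_{j=1}^{r} B_j 𝒦_j x̂_j^⋄(k) + L_i (H_i x(k) − H_i x̂_i^⋄(k)), is stable: x(k) → 0 and x̂_i^⋄(k) → 0 as k → ∞ for all initial conditions. -/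
open Matrix Filter Topology

section helpers

attribute [local instance] Matrix.linftyOpNormedRing Matrix.linftyOpNormedAlgebra

theorem aux_summable {n : ℕ} (M : Matrix (Fin n) (Fin n) ℝ) (hM : IsStable M) :
    Summable fun k : ℕ => ‖M ^ k‖ := by
  rcases Nat.eq_zero_or_pos n with h0 | hn
  · subst h0
    have : ∀ k : ℕ, ‖M ^ k‖ = 0 := fun k => by
      rw [Subsingleton.elim (M ^ k) 0, norm_zero]
    simp only [this]
    exact summable_zero
  · have : Nonempty (Fin n) := ⟨⟨0, hn⟩⟩
    set N : Matrix (Fin n) (Fin n) ℂ := M.map (algebraMap ℝ ℂ) with hN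
    have hpow : ∀ k : ℕ, ‖M ^ k‖ = ‖N ^ k‖ := by
      intro k
      have : N ^ k = (M ^ k).map (algebraMap ℝ ℂ) := by
        rw [hN]
        exact ((algebraMap ℝ ℂ).mapMatrix.map_pow M k).symm
      rw [this, ← coe_nnnorm, ← coe_nnnorm, Matrix.linfty_opNNNorm_def, Matrix.linfty_opNNNorm_def]
      simp
    have : CompleteSpace (Matrix (Fin n) (Fin n) ℂ) := FiniteDimensional.complete ℂ _
    have hr : spectralRadius ℂ N < ((1 : NNReal) : ENNReal) := by
      apply spectrum.spectralRadius_lt_of_forall_lt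
      intro μ hμ
      exact hM μ hμ
    obtain ⟨c, hc1, hc2⟩ := ENNReal.lt_iff_exists_nnreal_btwn.1 hr
    have hc2' : c < 1 := by exact_mod_cast hc2
    have hg := spectrum.pow_nnnorm_pow_one_div_tendsto_nhds_spectralRadius N
    have hev := hg.eventually (gt_mem_nhds hc1)
    have hgeo : Summable fun k : ℕ => (c : ℝ) ^ k :=
      summable_geometric_of_lt_one c.2 (by exact_mod_cast hc2')
    refine Summable.of_norm_bounded_eventually_nat hgeo ?_
    filter_upwards [hev, eventually_gt_atTop 0] with k hk hk0
    rw [norm_norm, hpow]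
    have h1 : ((‖N ^ k‖₊ : ENNReal) ^ (1 / (k:ℝ))) ^ (k:ℝ) ≤ (c : ENNReal) ^ (k:ℝ) :=
      ENNReal.rpow_le_rpow hk.le (by positivity)
    rw [← ENNReal.rpow_mul, one_div_mul_cancel (by positivity), ENNReal.rpow_one,
      ENNReal.rpow_natCast] at h1
    exact_mod_cast h1

theorem aux_iss {n : ℕ} (M : Matrix (Fin n) (Fin n) ℝ) (hM : IsStable M)
    (z w : ℕ → Fin n → ℝ) (hz : ∀ k, z (k + 1) = M *ᵥ z k + w k)
    (hw : Tendsto w atTop (𝓝 0)) : Tendsto z atTop (𝓝 0) := by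
  have hs := aux_summable M hM
  have hform : ∀ k, z k = (M ^ k) *ᵥ z 0 + ∑ j ∈ Finset.range k, (M ^ j) *ᵥ w (k - 1 - j) := by
    intro k
    induction k with
    | zero => simp
    | succ k ih =>
      rw [hz, ih, Finset.sum_range_succ', mulVec_add, mulVec_mulVec, ← pow_succ', mulVec_sum,
        add_assoc]
      simp only [mulVec_mulVec, ← pow_succ', pow_zero, one_mulVec]
      congr 2
      apply Finset.sum_congr rfl
      intro j hj
      congr 2
      omega
  have h1 : Tendsto (fun k => (M ^ k) *ᵥ z 0) atTop (𝓝 0) := by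
    have h := hs.tendsto_atTop_zero.mul_const ‖z 0‖
    rw [zero_mul] at h
    exact squeeze_zero_norm (fun k => Matrix.linfty_opNorm_mulVec _ _) h
  obtain ⟨C, hC⟩ := hw.norm.bddAbove_range
  have hC' : ∀ k, ‖w k‖ ≤ C := fun k => hC ⟨k, rfl⟩
  have hC0 : 0 ≤ C := (norm_nonneg _).trans (hC' 0)
  have h2 := tendsto_tsum_of_dominated_convergence (𝓕 := atTop)
    (f := fun (k j : ℕ) => if j ∈ Finset.range k then (M ^ j) *ᵥ w (k - 1 - j) else 0)
    (g := fun _ => 0) (bound := fun j => ‖M ^ j‖ * C) (hs.mul_right C)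
    (by
      intro j
      have hsub : Tendsto (fun k : ℕ => k - 1 - j) atTop atTop :=
        (tendsto_sub_atTop_nat j).comp (tendsto_sub_atTop_nat 1)
      have h := ((hw.comp hsub).norm).const_mul ‖M ^ j‖
      rw [norm_zero, mul_zero] at h
      refine squeeze_zero_norm (fun k => ?_) h
      split_ifs
      · exact Matrix.linfty_opNorm_mulVec _ _
      · rw [norm_zero]; positivity)
    (by
      refine Eventually.of_forall fun k j => ?_
      split_ifs
      · exact (Matrix.linfty_opNorm_mulVec _ _).trans
          (mul_le_mul_of_nonneg_left (hC' _) (norm_nonneg _))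
      · rw [norm_zero]; positivity)
  rw [tsum_zero] at h2
  have h3 := h1.add h2
  rw [add_zero] at h3
  refine h3.congr fun k => ?_
  rw [hform k, tsum_eq_sum (s := Finset.range k) (fun j hj => if_neg hj)]
  congr 1
  exact Finset.sum_congr rfl fun j hj => if_pos hj

end helpers

/-- Theorem 5: closed-loop stability with `r` inputs under input sharing.  With
`𝔹 = [B₁ ⋯ B_r]`, `ℛ = blockdiag(R₁,…,R_r)`, `𝒫 ⪰ 0` solving the ARE,
`𝒦 = −(ℛ + 𝔹'𝒫𝔹)⁻¹𝔹'𝒫A` split into row blocks `𝒦_i`, `A + 𝔹𝒦` stable and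
`A − L_iH_i` stable for all `i`, the state and all observers converge to zero. -/
theorem closed_loop_stable_input_sharing_multi {n r : ℕ} {m s : Fin r → ℕ}
    (A : Matrix (Fin n) (Fin n) ℝ)
    (B : ∀ i, Matrix (Fin n) (Fin (m i)) ℝ)
    (H : ∀ i, Matrix (Fin (s i)) (Fin n) ℝ)
    (Q : Matrix (Fin n) (Fin n) ℝ)
    (R : ∀ i, Matrix (Fin (m i)) (Fin (m i)) ℝ)
    (P : Matrix (Fin n) (Fin n) ℝ)
    (bbB : Matrix (Fin n) ((i : Fin r) × Fin (m i)) ℝ)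
    (hbbB : bbB = Matrix.of fun i p => B p.1 i p.2)
    (calR : Matrix ((i : Fin r) × Fin (m i)) ((i : Fin r) × Fin (m i)) ℝ)
    (hcalR : calR = Matrix.blockDiagonal' R)
    (hQ : Q.PosSemidef) (hR : ∀ i, (R i).PosDef) (hP : P.PosSemidef)
    (hARE : P = Aᵀ * P * A + Q -
      Aᵀ * P * bbB * (calR + bbBᵀ * P * bbB)⁻¹ * (bbBᵀ * P * A))
    (calK : Matrix ((i : Fin r) × Fin (m i)) (Fin n) ℝ)
    (hcalK : calK = -((calR + bbBᵀ * P * bbB)⁻¹ * (bbBᵀ * P * A)))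
    (K : ∀ i, Matrix (Fin (m i)) (Fin n) ℝ)
    (hK : ∀ i, K i = calK.submatrix
      (fun j : Fin (m i) => (⟨i, j⟩ : (i : Fin r) × Fin (m i))) id)
    (hstab : IsStable (A + bbB * calK))
    (L : ∀ i, Matrix (Fin n) (Fin (s i)) ℝ)
    (hL : ∀ i, IsStable (A - L i * H i))
    (x : ℕ → Fin n → ℝ) (xh : Fin r → ℕ → Fin n → ℝ)
    (hx : ∀ k, x (k + 1) = A.mulVec (x k) + ∑ i, (B i * K i).mulVec (xh i k))
    (hxh : ∀ i k, xh i (k + 1) =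
      A.mulVec (xh i k) + (∑ j, (B j * K j).mulVec (xh j k)) +
        (L i).mulVec ((H i).mulVec (x k) - (H i).mulVec (xh i k))) :
    Tendsto x atTop (𝓝 0) ∧ ∀ i, Tendsto (xh i) atTop (𝓝 0) := by
  have he : ∀ i, Tendsto (fun k => x k - xh i k) atTop (𝓝 0) := by
    intro i
    refine aux_iss _ (hL i) _ (fun _ => 0) (fun k => ?_) tendsto_const_nhds
    rw [hx, hxh, sub_mulVec, mulVec_sub, mulVec_sub, mulVec_sub, mulVec_mulVec,
      mulVec_mulVec]
    abel
  have hBK : bbB * calK = ∑ i, B i * K i := by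
    ext a b
    rw [Matrix.sum_apply, Matrix.mul_apply, Fintype.sum_sigma]
    refine Finset.sum_congr rfl fun i _ => ?_
    rw [Matrix.mul_apply, hK, hbbB]
    rfl
  have hxt : Tendsto x atTop (𝓝 0) := by
    refine aux_iss _ hstab x (fun k => -∑ i, (B i * K i) *ᵥ (x k - xh i k)) (fun k => ?_) ?_
    · rw [hx, hBK, add_mulVec, sum_mulVec]
      simp only [mulVec_sub, Finset.sum_sub_distrib]
      abel
    · have : Tendsto (fun k => -∑ i, (B i * K i) *ᵥ (x k - xh i k)) atTop
          (𝓝 (-∑ i, (B i * K i) *ᵥ (0 : Fin n → ℝ))) := by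
        refine (tendsto_finsetSum _ fun i _ => ?_).neg
        have hc : Continuous fun v : Fin n → ℝ => (B i * K i) *ᵥ v := by fun_prop
        exact (hc.tendsto 0).comp (he i)
      simpa using this
  refine ⟨hxt, fun i => ?_⟩
  have := hxt.sub (he i)
  simpa using this
end

section
/- (Theorem 6) Stability with r inputs under private input information: consider the closed loop x(k+1) = A x(k) + Σ_{i=1}^{r} B_i 𝒦_i x̂_i(k) with observers x̂_i(k+1) = A x̂_i(k) + Σ_{j=1}^{r} B_j 𝒦_j x̂_i(k) + ℒ_i (H_i x(k) − H_i x̂_i(k)) for i = 1,…,r. If the observer gains ℒ_i are chosen so that the block matrix 𝔸 ∈ ℝ^{rn×rn}, with (i,i) block A + Σ_{j≠i} B_j𝒦_j − ℒ_iH_i and (i,j) block −B_j𝒦_j for j ≠ i, is stable, then x̂_i(k) − x(k) → 0 as k → ∞ for each i = 1,…,r and all initial conditions; if in addition A + Σ_{i=1}^{r} B_i𝒦_i is stable, then x(k) → 0 as k → ∞ for all initial conditions. -/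
open Matrix Finset Filter Topology

/-- scalar lemma -/
theorem aux_scalar (ρ : ℝ) (h0 : 0 ≤ ρ) (h1 : ρ < 1) (g w : ℕ → ℝ)
    (hg : ∀ k, 0 ≤ g k) (hw : Tendsto w atTop (𝓝 0))
    (h : ∀ k, g (k + 1) = ρ * g k + w k) : Tendsto g atTop (𝓝 0) := by
  rw [Metric.tendsto_atTop]
  intro ε hε
  have hδ : 0 < (1 - ρ) * (ε / 2) := by
    have : 0 < 1 - ρ := by linarith
    positivity
  obtain ⟨K0, hK⟩ := (Metric.tendsto_atTop.1 hw) _ hδ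
  have hb : ∀ q, g (K0 + q) ≤ ε / 2 + ρ ^ q * g K0 := by
    intro q
    induction q with
    | zero => simp; linarith
    | succ q ih =>
      have h2 := hK (K0 + q) (by omega)
      rw [Real.dist_eq, sub_zero] at h2
      have h3 := (abs_lt.1 h2).2
      rw [← add_assoc, h, pow_succ]
      nlinarith [mul_le_mul_of_nonneg_left ih h0]
  have ht : Tendsto (fun q : ℕ => ρ ^ q * g K0) atTop (𝓝 0) := by
    simpa using (tendsto_pow_atTop_nhds_zero_of_lt_one h0 h1).mul_const (g K0)
  obtain ⟨Q, hQ⟩ := (Metric.tendsto_atTop.1 ht) (ε / 2) (by linarith)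
  refine ⟨K0 + Q, fun k hk => ?_⟩
  obtain ⟨q, rfl⟩ := Nat.exists_eq_add_of_le (show K0 ≤ k by omega)
  have h2 := hQ q (by omega)
  rw [Real.dist_eq, sub_zero] at h2 ⊢
  rw [abs_of_nonneg (hg _)]
  linarith [hb q, (abs_lt.1 h2).2]

section
attribute [local instance] Matrix.linftyOpNormedRing Matrix.linftyOpNormedAlgebra
  Matrix.linftyOpNormedAddCommGroup

theorem aux_pow {ι : Type*} [Fintype ι] [DecidableEq ι] (M : Matrix ι ι ℂ)
    (hM : ∀ μ ∈ spectrum ℂ M, ‖μ‖ < 1) :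
    ∃ C ρ : ℝ, 0 ≤ ρ ∧ ρ < 1 ∧ ∀ k, ‖M ^ k‖ ≤ C * ρ ^ k := by
  have hs : spectralRadius ℂ M < 1 := by
    rcases (spectrum ℂ M).eq_empty_or_nonempty with h | h
    · simp [spectralRadius, h]
    · exact_mod_cast spectrum.spectralRadius_lt_of_forall_lt_of_nonempty (r := 1) h
        (fun k hk => by exact_mod_cast hM k hk)
  obtain ⟨ρ, hρ1, hρ2⟩ := ENNReal.lt_iff_exists_nnreal_btwn.1 hs
  have hρ0 : 0 < ρ := by exact_mod_cast (zero_le (a := spectralRadius ℂ M)).trans_lt hρ1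
  have : CompleteSpace (Matrix ι ι ℂ) := FiniteDimensional.complete ℂ _
  have ht := spectrum.pow_nnnorm_pow_one_div_tendsto_nhds_spectralRadius M
  have he := (ht.eventually (gt_mem_nhds hρ1)).and (eventually_ge_atTop 1)
  obtain ⟨N, hN⟩ := eventually_atTop.1 he
  refine ⟨1 + ∑ i ∈ range N, ‖M ^ i‖ / ρ ^ i, ρ, ρ.2, by exact_mod_cast hρ2, fun k => ?_⟩
  have hρ0' : (0 : ℝ) < ρ := hρ0
  have hnn : ∀ i ∈ range N, 0 ≤ ‖M ^ i‖ / (ρ : ℝ) ^ i := fun i _ => by positivity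
  rw [← div_le_iff₀ (by positivity)]
  by_cases hk : k < N
  · have := single_le_sum hnn (mem_range.2 hk)
    linarith
  · obtain ⟨h1, h2⟩ := hN k (by omega)
    have h3 := ENNReal.rpow_le_rpow h1.le (show (0 : ℝ) ≤ k by positivity)
    rw [← ENNReal.rpow_mul, one_div_mul_cancel (by positivity), ENNReal.rpow_one,
      ENNReal.rpow_natCast] at h3
    have h4 : ‖M ^ k‖ ≤ (ρ : ℝ) ^ k := by exact_mod_cast h3
    have := sum_nonneg hnn
    have : ‖M ^ k‖ / (ρ : ℝ) ^ k ≤ 1 := by rw [div_le_one (by positivity)]; exact h4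
    linarith

theorem aux_cplx {ι : Type*} [Fintype ι] [DecidableEq ι] (M : Matrix ι ι ℂ)
    (hM : ∀ μ ∈ spectrum ℂ M, ‖μ‖ < 1) (z w : ℕ → ι → ℂ)
    (hw : Tendsto w atTop (𝓝 0)) (h : ∀ k, z (k + 1) = M *ᵥ z k + w k) :
    Tendsto z atTop (𝓝 0) := by
  obtain ⟨C, ρ, h0, h1, hC⟩ := aux_pow M hM
  let g : ℕ → ℝ := fun k => Nat.rec ‖z 0‖ (fun k y => ρ * y + ‖w k‖) k
  have hgs : ∀ k, g (k + 1) = ρ * g k + ‖w k‖ := fun k => rfl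
  have hg : ∀ k, 0 ≤ g k := by
    intro k
    induction k with
    | zero => exact norm_nonneg _
    | succ k ih => rw [hgs]; positivity
  have hgt := aux_scalar ρ h0 h1 g _ hg (by simpa using hw.norm) hgs
  have hb : ∀ k j, ‖M ^ j *ᵥ z k‖ ≤ C * ρ ^ j * g k := by
    intro k
    induction k with
    | zero =>
      intro j
      exact (Matrix.linfty_opNorm_mulVec _ _).trans
        (mul_le_mul_of_nonneg_right (hC j) (norm_nonneg _))
    | succ k ih =>
      intro j
      rw [h, Matrix.mulVec_add, Matrix.mulVec_mulVec, ← pow_succ, hgs]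
      refine (norm_add_le _ _).trans ?_
      have e1 := ih (j + 1)
      have e2 := (Matrix.linfty_opNorm_mulVec (M ^ j) (w k)).trans
        (mul_le_mul_of_nonneg_right (hC j) (norm_nonneg _))
      rw [pow_succ ρ] at e1
      linarith
  refine squeeze_zero_norm (a := fun k => C * g k) (fun k => ?_) (by simpa using hgt.const_mul C)
  simpa using hb k 0
end

theorem aux_real {ι : Type*} [Fintype ι] [DecidableEq ι] (M : Matrix ι ι ℝ)
    (hM : IsStable M) (z w : ℕ → ι → ℝ)
    (hw : Tendsto w atTop (𝓝 0)) (h : ∀ k, z (k + 1) = M *ᵥ z k + w k) :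
    Tendsto z atTop (𝓝 0) := by
  have key := aux_cplx (M.map (algebraMap ℝ ℂ)) hM (fun k i => (z k i : ℂ))
    (fun k i => (w k i : ℂ)) ?_ ?_
  · rw [tendsto_pi_nhds] at key ⊢
    intro i
    have := (Complex.continuous_re.tendsto _).comp (key i)
    simpa [Function.comp_def] using this
  · rw [tendsto_pi_nhds] at hw ⊢
    intro i
    have := (Complex.continuous_ofReal.tendsto _).comp (hw i)
    simpa [Function.comp_def] using this
  · intro k
    ext i
    simp [h, Matrix.mulVec, dotProduct]

/-- Theorem 6: stability with `r` inputs under private input information.  If the block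
matrix `𝔸` (with `(i,i)` block `A + Σ_{j≠i} B_j𝒦_j − ℒ_iH_i` and `(i,j)` block
`−B_j𝒦_j` for `j ≠ i`) is stable, then every observer error converges to zero; if in
addition `A + Σ_i B_i𝒦_i` is stable, then the state converges to zero. -/
theorem stability_private_input_multi {n r : ℕ} {m s : Fin r → ℕ}
    (A : Matrix (Fin n) (Fin n) ℝ)
    (B : ∀ i, Matrix (Fin n) (Fin (m i)) ℝ)
    (H : ∀ i, Matrix (Fin (s i)) (Fin n) ℝ)
    (K : ∀ i, Matrix (Fin (m i)) (Fin n) ℝ)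
    (L : ∀ i, Matrix (Fin n) (Fin (s i)) ℝ)
    (bbA : Matrix (Fin r × Fin n) (Fin r × Fin n) ℝ)
    (hbbA : bbA = Matrix.of fun p q =>
      if p.1 = q.1 then
        (A + (∑ j ∈ univ.erase p.1, B j * K j) - L p.1 * H p.1) p.2 q.2
      else (-(B q.1 * K q.1)) p.2 q.2)
    (hstabA : IsStable bbA)
    (x : ℕ → Fin n → ℝ) (xh : Fin r → ℕ → Fin n → ℝ)
    (hx : ∀ k, x (k + 1) = A.mulVec (x k) + ∑ i, (B i * K i).mulVec (xh i k))
    (hxh : ∀ i k, xh i (k + 1) =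
      A.mulVec (xh i k) + (∑ j, (B j * K j)).mulVec (xh i k) +
        (L i).mulVec ((H i).mulVec (x k) - (H i).mulVec (xh i k))) :
    (∀ i, Tendsto (fun k => xh i k - x k) atTop (𝓝 0)) ∧
    (IsStable (A + ∑ i, B i * K i) → Tendsto x atTop (𝓝 0)) := by
  have he : ∀ i, Tendsto (fun k => xh i k - x k) atTop (𝓝 0) := by
    have key := aux_real bbA hstabA (fun k p => xh p.1 k p.2 - x k p.2) (fun _ => 0)
      tendsto_const_nhds ?_
    · intro i
      rw [tendsto_pi_nhds] at key ⊢
      intro a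
      exact key (i, a)
    · intro k
      have hv : ∀ i, xh i (k + 1) - x (k + 1) =
          (A + (∑ j ∈ univ.erase i, B j * K j) - L i * H i) *ᵥ (xh i k - x k)
          + ∑ j ∈ univ.erase i, (-(B j * K j)) *ᵥ (xh j k - x k) := by
        intro i
        rw [hx, hxh, ← add_sum_erase univ (fun j => B j * K j) (mem_univ i),
          ← add_sum_erase univ (fun j => (B j * K j) *ᵥ xh j k) (mem_univ i)]
        simp only [Matrix.sub_mulVec, Matrix.add_mulVec, Matrix.mulVec_sub, Matrix.neg_mulVec,
          Matrix.sum_mulVec, Matrix.mulVec_mulVec, sum_sub_distrib, sum_neg_distrib]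
        abel
      ext ⟨i, a⟩
      have := congrFun (hv i) a
      simp only [Pi.sub_apply] at this
      rw [this, hbbA]
      simp only [Pi.add_apply, Pi.zero_apply, add_zero, Matrix.mulVec, dotProduct,
        Fintype.sum_prod_type, Matrix.of_apply]
      rw [← add_sum_erase univ _ (mem_univ i)]
      simp only [if_true, Finset.sum_apply, Pi.sub_apply]
      congr 1
      refine sum_congr rfl fun j hj => ?_
      simp [(ne_of_mem_erase hj).symm, Matrix.mulVec, dotProduct]
  refine ⟨he, fun hs => ?_⟩
  refine aux_real _ hs x (fun k => ∑ i, (B i * K i) *ᵥ (xh i k - x k)) ?_ ?_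
  · have : Tendsto (fun k => ∑ i, (B i * K i) *ᵥ (xh i k - x k)) atTop
        (𝓝 (∑ i, (B i * K i) *ᵥ (0 : Fin n → ℝ))) := by
      refine tendsto_finsetSum _ fun i _ => ?_
      have hc : Continuous fun v : Fin n → ℝ => (B i * K i) *ᵥ v := by fun_prop
      exact (hc.tendsto 0).comp (he i)
    simpa using this
  · intro k
    rw [hx]
    simp only [Matrix.add_mulVec, Matrix.sum_mulVec, Matrix.mulVec_sub, sum_sub_distrib]
    abel
end
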